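/- arXiv:1409.3897 — 3 statements merged into one kernel-verified Lean document; each statement's English description precedes it below -/
import Mathlib

section
/- Let d ≥ 2 and let p = (p_1,…,p_d) be a non-uniform probability distribution with all p_i > 0. Let 0 < r < D(P_{1/2}‖p), where P_{1/2}(i) = √p_i/Σ_j √p_j (equivalently, r < −(1/4)·H'_{1/2}(p), the derivative of α ↦ H_α(p) at α = 1/2). Then for all sufficiently large n there exists a weighting collection {m_ω}_{ω∈Ω} on {1,…,d}^n, with Σ_{x⃗} P^n(x⃗) m_ω(x⃗) > 0 for each ω, such that Σ_{ω∈Ω} |supp m_ω| · ( Σ_{x⃗} P^n(x⃗) m_ω(x⃗)² ) / ( Σ_{x⃗} P^n(x⃗) m_ω(x⃗) ) ≤ 8d·(n+1)^{3(d−1)} · exp( −n·sup_{0 ≤ s < 1}[ (−2s/(1−s))·r − H_{(1+s)/2}(p) ] ), and 1 − Σ_{ω∈Ω} Σ_{x⃗} P^n(x⃗) m_ω(x⃗) ≤ (n+1)^{d−1} e^{−nr}. -/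
open scoped BigOperators Classical
open Real

/-- Rényi entropy of order `a ≠ 1` (natural log). -/
noncomputable def renyiH {d : ℕ} (p : Fin d → ℝ) (a : ℝ) : ℝ :=
  (1 / (1 - a)) * Real.log (∑ i, p i ^ a)

/-- Relative entropy `D(Q‖P)` (with the convention `0 log 0 = 0`). -/
noncomputable def relEnt {d : ℕ} (Q P : Fin d → ℝ) : ℝ :=
  ∑ i, Q i * Real.log (Q i / P i)

/-- The distribution `P_{1/2}(i) = √p_i / Σ_j √p_j`. -/
noncomputable def pHalf {d : ℕ} (p : Fin d → ℝ) : Fin d → ℝ :=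
  fun i => Real.sqrt (p i) / ∑ j, Real.sqrt (p j)

/-- Product probability `P^n(x)` of a string. -/
noncomputable def prodP {d : ℕ} (p : Fin d → ℝ) {n : ℕ} (x : Fin n → Fin d) : ℝ :=
  ∏ k, p (x k)

/-- `{m_j}` is a weighting collection: each `m_j` takes values in `[0,1]`
and `Σ_j m_j(x) ≤ 1` for all `x`. -/
def IsWeighting {d n M : ℕ} (m : Fin M → (Fin n → Fin d) → ℝ) : Prop :=
  (∀ j x, 0 ≤ m j x) ∧ (∀ j x, m j x ≤ 1) ∧ (∀ x, ∑ j, m j x ≤ 1)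

/-- Cardinality of the support of `m_j`. -/
noncomputable def suppCard {d n : ℕ} (f : (Fin n → Fin d) → ℝ) : ℝ :=
  ((Finset.univ.filter (fun x => f x ≠ 0)).card : ℝ)

/-- A finite set can be coloured with `N` colours in a balanced way. -/
theorem exists_balanced_coloring {X : Type*} (S : Finset X) {N : ℕ} (hN : 0 < N) :
    ∃ f : X → Fin N, ∀ j, (S.filter (fun x => f x = j)).card ≤ S.card / N + 1 := by
  set k := S.card / N + 1 with hk
  have hlt : ∀ i : Fin S.card, (i : ℕ) / k < N := by
    intro i
    rw [Nat.div_lt_iff_lt_mul (show 0 < k from Nat.succ_pos _)]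
    have h1 := Nat.lt_div_mul_add (a := S.card) hN
    have h2 := i.isLt
    rw [hk]
    nlinarith
  refine ⟨fun x => if h : x ∈ S then ⟨(S.equivFin ⟨x, h⟩ : ℕ) / k, hlt _⟩ else ⟨0, hN⟩, ?_⟩
  intro j
  have hcard : (Finset.Ico (j * k : ℕ) (j * k + k)).card = k := by simp
  refine le_trans (Finset.card_le_card_of_injOn
    (fun x => if h : x ∈ S then (S.equivFin ⟨x, h⟩ : ℕ) else 0) ?_ ?_) hcard.le
  · intro x hx
    obtain ⟨hxS, hxj⟩ := Finset.mem_filter.1 (Finset.mem_coe.1 hx)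
    simp only [hxS, dif_pos, Fin.ext_iff] at hxj
    simp only [hxS, dif_pos, Finset.coe_Ico, Set.mem_Ico]
    rw [← hxj]
    refine ⟨Nat.div_mul_le_self _ _, ?_⟩
    exact Nat.lt_div_mul_add (Nat.succ_pos _)
  · intro x hx y hy hxy
    have hxS := (Finset.mem_filter.1 (Finset.mem_coe.1 hx)).1
    have hyS := (Finset.mem_filter.1 (Finset.mem_coe.1 hy)).1
    simp only [hxS, hyS, dif_pos] at hxy
    simpa using S.equivFin.injective (Fin.ext hxy)

/-- The weight that is `1` on the part `A` and `c` on the reservoir `B`. -/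
noncomputable def reservoirWeight {X : Type*} (A B : Finset X) (c : ℝ) (x : X) : ℝ :=
  if x ∈ B then c else if x ∈ A then 1 else 0

theorem reservoirWeight_nonneg {X : Type*} (A B : Finset X) {c : ℝ} (hc : 0 ≤ c) (x : X) :
    0 ≤ reservoirWeight A B c x := by
  unfold reservoirWeight
  split_ifs <;> simp [hc]

theorem sum_mul_reservoirWeight_ge {X : Type*} [Fintype X] {P : X → ℝ} (hP : ∀ x, 0 ≤ P x)
    (A B : Finset X) (c : ℝ) :
    c * ∑ x ∈ B, P x ≤ ∑ x, P x * reservoirWeight A B c x := by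
  have h : c * ∑ x ∈ B, P x = ∑ x, if x ∈ B then P x * c else 0 := by
    rw [← Finset.sum_filter, Finset.filter_mem_eq_inter, Finset.univ_inter, Finset.mul_sum]
    exact Finset.sum_congr rfl fun x _ => mul_comm _ _
  rw [h]
  refine Finset.sum_le_sum fun x _ => ?_
  unfold reservoirWeight
  have := hP x
  split_ifs <;> simp [this]

theorem sum_mul_reservoirWeight_sq_le {X : Type*} [Fintype X] {P : X → ℝ} (hP : ∀ x, 0 ≤ P x)
    (A B : Finset X) (c : ℝ) :
    ∑ x, P x * reservoirWeight A B c x ^ 2 ≤ ∑ x ∈ A, P x + c ^ 2 * ∑ x ∈ B, P x := by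
  have h : ∑ x ∈ A, P x + c ^ 2 * ∑ x ∈ B, P x
      = ∑ x, ((if x ∈ A then P x else 0) + if x ∈ B then P x * c ^ 2 else 0) := by
    rw [Finset.sum_add_distrib, ← Finset.sum_filter, ← Finset.sum_filter,
      Finset.filter_mem_eq_inter, Finset.univ_inter, Finset.filter_mem_eq_inter,
      Finset.univ_inter, Finset.mul_sum]
    congr 1
    exact Finset.sum_congr rfl fun x _ => mul_comm _ _
  rw [h]
  refine Finset.sum_le_sum fun x _ => ?_
  unfold reservoirWeight
  have := hP x
  split_ifs <;> simp [this]

theorem card_support_reservoirWeight_le {X : Type*} [Fintype X] (A B : Finset X) (c : ℝ) :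
    (Finset.univ.filter (fun x => reservoirWeight A B c x ≠ 0)).card ≤ A.card + B.card := by
  refine le_trans (Finset.card_le_card ?_) (Finset.card_union_le A B)
  intro x hx
  have hx := (Finset.mem_filter.1 hx).2
  unfold reservoirWeight at hx
  rw [Finset.mem_union]
  by_contra h
  push Not at h
  simp [h.1, h.2] at hx

/-- Total cost of the weights obtained by splitting one class, of size `a` and probability `a * w`,
into `N` parts of size `k j` and mixing each part with a reservoir of size `b` and
probability `pB`. -/
theorem sum_cost_le {N : ℕ} {a w b pB κ E : ℝ} (ha : 0 < a) (hw : 0 < w) (hb : 1 ≤ b)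
    (hpB : 0 < pB) (hpB1 : pB ≤ 1) (hκ : 1 ≤ κ) (hE : a * (a * w) ≤ E)
    (hN : (N : ℝ) ≤ 1 / (a * w * κ) + 1) (hN' : 1 / (a * w * κ) ≤ N)
    (k : Fin N → ℝ) (hk0 : ∀ j, 0 ≤ k j) (hk : ∀ j, k j ≤ a / N + 1) (hksum : ∑ j, k j = a) :
    ∑ j, (k j + b) * (k j * w + (1 / (N * κ)) ^ 2 * pB) / (1 / (N * κ) * pB)
      ≤ (2 * κ * E + 2 * b * (2 + κ * (a * w))) / pB := by
  have hκ0 : 0 < κ := by linarith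
  have hu : 0 < a * w := by positivity
  have hN0 : (0 : ℝ) < N := lt_of_lt_of_le (by positivity) hN'
  have h1 : ∀ j ∈ Finset.univ,
      (k j + b) * (k j * w + (1 / (N * κ)) ^ 2 * pB) / (1 / (N * κ) * pB)
      ≤ (a / N + 1 + b) * (N * κ * w * k j + 1 / (N * κ)) / pB := by
    intro j _
    have e : (k j + b) * (k j * w + (1 / (N * κ)) ^ 2 * pB) / (1 / (N * κ) * pB)
        = (k j + b) * (N * κ * w * k j + 1 / (N * κ) * pB) / pB := by
      field_simp
    rw [e]
    have := hk0 j
    have h3 : 1 / (N * κ) * pB ≤ 1 / (N * κ) := mul_le_of_le_one_right (by positivity) hpB1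
    gcongr
    exact hk j
  refine (Finset.sum_le_sum h1).trans ?_
  rw [← Finset.sum_div, ← Finset.mul_sum, Finset.sum_add_distrib, ← Finset.mul_sum, hksum]
  simp only [Finset.sum_const, Finset.card_univ, Fintype.card_fin, nsmul_eq_mul]
  refine div_le_div_of_nonneg_right ?_ hpB.le
  have e2 : (N : ℝ) * (1 / (N * κ)) = 1 / κ := by field_simp
  rw [e2]
  have h4 : a / N ≤ a * (a * w) * κ := by
    rw [div_le_iff₀ hN0]
    rw [div_le_iff₀ (by positivity)] at hN'
    nlinarith
  have h5 : N * κ * w * a ≤ 1 + κ * (a * w) := by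
    have : (1 / (a * w * κ) + 1) * (a * w * κ) = 1 + κ * (a * w) := by field_simp
    have := mul_le_mul_of_nonneg_right hN (show 0 ≤ a * w * κ by positivity)
    linarith
  have h6 : 1 / κ ≤ 1 := by rw [div_le_one hκ0]; exact hκ
  have h7 : a / N * (N * κ * w * a) = κ * (a * (a * w)) := by field_simp
  have h8 : a / N * (1 / κ) ≤ a * (a * w) := by
    calc a / N * (1 / κ) ≤ a * (a * w) * κ * (1 / κ) := by gcongr
      _ = a * (a * w) := by field_simp
  have h9 : (1 + b) * (N * κ * w * a + 1 / κ) ≤ 2 * b * (2 + κ * (a * w)) := by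
    have : 0 ≤ N * κ * w * a + 1 / κ := by positivity
    calc (1 + b) * (N * κ * w * a + 1 / κ) ≤ (2 * b) * (N * κ * w * a + 1 / κ) := by
          gcongr; linarith
      _ ≤ 2 * b * (2 + κ * (a * w)) := mul_le_mul_of_nonneg_left (by linarith) (by linarith)
  have h10 : κ * (a * (a * w)) + a * (a * w) ≤ 2 * κ * E := by
    have h0 : 0 ≤ a * (a * w) := by positivity
    nlinarith
  calc (a / N + 1 + b) * (N * κ * w * a + 1 / κ)
      = a / N * (N * κ * w * a) + a / N * (1 / κ) + (1 + b) * (N * κ * w * a + 1 / κ) := by ring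
    _ ≤ 2 * κ * E + 2 * b * (2 + κ * (a * w)) := by rw [h7]; linarith

/-- Summation of the bound of `sum_cost_le` over all classes. -/
theorem sum_class_cost_le {τ : Type*} (K : Finset τ) {u : τ → ℝ} (hu : ∑ Q ∈ K, u Q ≤ 1)
    {T b pB E : ℝ} (hKT : (K.card : ℝ) ≤ T) (hE : 0 ≤ E) (hb : 0 ≤ b) (hpB : 0 < pB)
    (hTB : 1 ≤ T * pB) (hbE : b * pB ≤ E) :
    ∑ Q ∈ K, (2 * K.card * E + 2 * b * (2 + K.card * u Q)) / pB ≤ 8 * T ^ 3 * E := by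
  have hT : 0 ≤ T := (Nat.cast_nonneg _).trans hKT
  have hbT : b ≤ T * E := by
    calc b ≤ b * (T * pB) := le_mul_of_one_le_right hb hTB
      _ = T * (b * pB) := by ring
      _ ≤ T * E := by gcongr
  have hsplit : ∑ Q ∈ K, (2 * K.card * E + 2 * b * (2 + K.card * u Q))
      = K.card * (2 * K.card * E) + 2 * b * (K.card * 2 + K.card * ∑ Q ∈ K, u Q) := by
    simp only [Finset.sum_add_distrib, ← Finset.mul_sum, Finset.sum_const, nsmul_eq_mul]
    ring
  rw [← Finset.sum_div, div_le_iff₀ hpB, hsplit]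
  calc K.card * (2 * K.card * E) + 2 * b * (K.card * 2 + K.card * ∑ Q ∈ K, u Q)
      ≤ K.card * (2 * K.card * E) + 2 * b * (K.card * 2 + K.card * 1) := by gcongr
    _ ≤ T * (2 * T * E) + 2 * (T * E) * (T * 2 + T * 1) := by gcongr
    _ = 8 * T ^ 2 * E := by ring
    _ ≤ 8 * T ^ 2 * E * (T * pB) := le_mul_of_one_le_right (by positivity) hTB
    _ = 8 * T ^ 3 * E * pB := by ring

/-- If a distribution `P` on `X` is constant on the classes of `t : X → τ`, there is a weighting
collection which covers every class of probability at least `θ` and is cheap as soon as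
`|class| * P(class) ≤ E` for these classes. -/
theorem exists_cheap_weighting {X τ : Type*} [Fintype X] [Fintype τ] [DecidableEq τ] (t : X → τ) (P : X → ℝ)
    (w : τ → ℝ) (hw : ∀ Q, 0 < w Q) (hPw : ∀ x, P x = w (t x)) (hP1 : ∑ x, P x = 1)
    {θ E : ℝ} (hθ : 0 < θ) (hE0 : 0 ≤ E)
    (hE : ∀ Q, θ ≤ ((Finset.univ.filter (fun x => t x = Q)).card : ℝ) * w Q →
      ((Finset.univ.filter (fun x => t x = Q)).card : ℝ) *
        (((Finset.univ.filter (fun x => t x = Q)).card : ℝ) * w Q) ≤ E) :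
    ∃ (M : ℕ) (m : Fin M → X → ℝ),
      (∀ j x, 0 ≤ m j x) ∧ (∀ x, ∑ j, m j x ≤ 1) ∧
      (∀ j, 0 < ∑ x, P x * m j x) ∧
      (∑ j, ((Finset.univ.filter (fun x => m j x ≠ 0)).card : ℝ) * (∑ x, P x * (m j x) ^ 2)
          / (∑ x, P x * m j x) ≤ 8 * (Fintype.card τ : ℝ) ^ 3 * E) ∧
      (1 - ∑ j, ∑ x, P x * m j x ≤ Fintype.card τ * θ) := by
  have hP0 : ∀ x, 0 ≤ P x := fun x => by rw [hPw]; exact (hw _).le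
  set C : τ → Finset X := fun Q => Finset.univ.filter (fun x => t x = Q) with hC
  have hmemC : ∀ x Q, x ∈ C Q ↔ t x = Q := fun x Q => by simp [hC]
  have hPC : ∀ (Q : τ) (S : Finset X), S ⊆ C Q → ∑ x ∈ S, P x = S.card * w Q := by
    intro Q S hS
    rw [Finset.sum_congr rfl (g := fun _ => w Q)
      (fun x hx => by rw [hPw, (hmemC x Q).1 (hS hx)])]
    simp
  have hfib : ∀ f : X → ℝ, ∑ x, f x = ∑ Q, ∑ x ∈ C Q, f x := fun f =>
    (Finset.sum_fiberwise Finset.univ t f).symm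
  have htot : ∑ Q, ((C Q).card : ℝ) * w Q = 1 := by
    rw [← hP1, hfib]
    exact Finset.sum_congr rfl fun Q _ => (hPC Q _ subset_rfl).symm
  have hτ : Nonempty τ := by
    by_contra h
    rw [not_nonempty_iff] at h
    simp at htot
  have hT0 : (0 : ℝ) < Fintype.card τ := by exact_mod_cast Fintype.card_pos
  obtain ⟨B, hB⟩ : ∃ B, 1 / (Fintype.card τ : ℝ) ≤ (C B).card * w B := by
    by_contra! h
    have := Finset.sum_lt_sum_of_nonempty (s := (Finset.univ : Finset τ))
      Finset.univ_nonempty (fun Q _ => h Q)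
    rw [htot] at this
    simp [hT0.ne'] at this
  by_cases hBθ : θ ≤ (C B).card * w B
  swap
  · refine ⟨0, fun j => j.elim0, fun j => j.elim0, by simp, fun j => j.elim0, ?_, ?_⟩
    · simp only [Finset.univ_eq_empty, Finset.sum_empty]
      positivity
    · simp only [Finset.univ_eq_empty, Finset.sum_empty, sub_zero]
      have : 1 / (Fintype.card τ : ℝ) ≤ θ := hB.trans (not_le.1 hBθ).le
      rwa [div_le_iff₀' hT0] at this
  set K : Finset τ := Finset.univ.filter (fun Q => θ ≤ (C Q).card * w Q) with hK
  have hBK : B ∈ K := by simp [hK, hBθ]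
  have hKθ : ∀ Q ∈ K, θ ≤ (C Q).card * w Q := fun Q hQ => (Finset.mem_filter.1 hQ).2
  have ha : ∀ Q ∈ K, (0 : ℝ) < (C Q).card := fun Q hQ =>
    pos_of_mul_pos_left (hθ.trans_le (hKθ Q hQ)) (hw Q).le
  set κ : ℝ := (K.card : ℝ) with hκ
  have hκ1 : 1 ≤ κ := by
    rw [hκ]; exact_mod_cast Finset.card_pos.2 ⟨B, hBK⟩
  have hκT : κ ≤ Fintype.card τ := by
    rw [hκ]; exact_mod_cast Finset.card_le_univ K
  have hκ0 : 0 < κ := by linarith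
  set N : τ → ℕ := fun Q => ⌈1 / ((C Q).card * w Q * κ)⌉₊ + (if Q ∈ K then 0 else 1) with hN
  have hNK : ∀ Q ∈ K, N Q = ⌈1 / ((C Q).card * w Q * κ)⌉₊ := fun Q hQ => by simp [hN, hQ]
  have hNpos : ∀ Q, 0 < N Q := by
    intro Q
    by_cases hQ : Q ∈ K
    · rw [hNK Q hQ, Nat.ceil_pos]
      exact one_div_pos.2 (mul_pos (mul_pos (ha Q hQ) (hw Q)) hκ0)
    · simp [hN, hQ]
  choose col hcol using fun Q => exists_balanced_coloring (C Q) (hNpos Q)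
  set A : (Q : τ) → Fin (N Q) → Finset X :=
    fun Q j => (C Q).filter (fun x => col Q x = j) with hA
  have hmemA : ∀ Q j x, x ∈ A Q j ↔ t x = Q ∧ col Q x = j := by
    intro Q j x
    simp only [hA, Finset.mem_filter, hmemC]
  set μ : (Q : τ) → Fin (N Q) → X → ℝ :=
    fun Q j => reservoirWeight (A Q j) (C B) (1 / (N Q * κ)) with hμ
  have hc0 : ∀ Q, (0 : ℝ) < 1 / (N Q * κ) := by
    intro Q
    exact one_div_pos.2 (mul_pos (Nat.cast_pos.2 (hNpos Q)) hκ0)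
  have hpB : (0 : ℝ) < (C B).card * w B := lt_of_lt_of_le hθ hBθ
  have hμ0 : ∀ Q j x, 0 ≤ μ Q j x := fun Q j x => reservoirWeight_nonneg _ _ (hc0 Q).le x
  have hμsum : ∀ x, ∑ Q ∈ K, ∑ j, μ Q j x = if t x ∈ K then 1 else 0 := by
    intro x
    by_cases hxB : t x = B
    · have h1 : ∀ Q ∈ K, ∑ j, μ Q j x = 1 / κ := by
        intro Q _
        have hN0 : (N Q : ℝ) ≠ 0 := Nat.cast_ne_zero.2 (hNpos Q).ne'
        have hval : ∀ j, μ Q j x = 1 / (N Q * κ) := fun j => if_pos ((hmemC x B).2 hxB)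
        rw [Finset.sum_congr rfl fun j _ => hval j, Finset.sum_const, Finset.card_univ,
          Fintype.card_fin, nsmul_eq_mul, one_div, mul_inv, mul_inv_cancel_left₀ hN0, one_div]
      rw [Finset.sum_congr rfl h1, hxB, if_pos hBK, Finset.sum_const, nsmul_eq_mul, ← hκ,
        mul_one_div_cancel hκ0.ne']
    · have h1 : ∀ Q ∈ K, ∑ j, μ Q j x = if t x = Q then 1 else 0 := by
        intro Q _
        have hxC : x ∉ C B := fun h => hxB ((hmemC x B).1 h)
        have hval : ∀ j, μ Q j x = if t x = Q ∧ col Q x = j then 1 else 0 := fun j =>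
          (if_neg hxC).trans (if_congr (hmemA Q j x) rfl rfl)
        rw [Finset.sum_congr rfl fun j _ => hval j]
        by_cases h : t x = Q
        · simp only [h, true_and, if_true, Finset.sum_ite_eq, Finset.mem_univ]
        · simp only [h, false_and, if_false, Finset.sum_const_zero]
      rw [Finset.sum_congr rfl h1, Finset.sum_ite_eq]
  have hpos : ∀ Q j, 0 < ∑ x, P x * μ Q j x := by
    intro Q j
    refine lt_of_lt_of_le ?_ (sum_mul_reservoirWeight_ge hP0 _ _ _)
    rw [hPC B _ subset_rfl]
    exact mul_pos (hc0 Q) hpB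
  have hpB1 : (C B).card * w B ≤ 1 := by
    rw [← htot]
    exact Finset.single_le_sum (f := fun Q => ((C Q).card : ℝ) * w Q)
      (fun Q _ => mul_nonneg (Nat.cast_nonneg _) (hw Q).le) (Finset.mem_univ B)
  have hb1 : (1 : ℝ) ≤ (C B).card := by
    have := ha B hBK
    exact_mod_cast Nat.cast_pos.1 this
  have hcostQ : ∀ Q ∈ K, ∑ j, ((Finset.univ.filter (fun x => μ Q j x ≠ 0)).card : ℝ) *
      (∑ x, P x * (μ Q j x) ^ 2) / (∑ x, P x * μ Q j x) ≤
      (2 * κ * E + 2 * (C B).card * (2 + κ * ((C Q).card * w Q))) / ((C B).card * w B) := by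
    intro Q hQ
    have haw : 0 < (C Q).card * w Q * κ := mul_pos (mul_pos (ha Q hQ) (hw Q)) hκ0
    refine le_trans (Finset.sum_le_sum fun j _ => ?_)
      (sum_cost_le (N := N Q) (k := fun j => ((A Q j).card : ℝ)) (ha Q hQ) (hw Q) hb1 hpB hpB1
        hκ1 (hE Q (hKθ Q hQ)) ?_ ?_ (fun j => Nat.cast_nonneg _) ?_ ?_)
    · have h0 : (0 : ℝ) ≤ (Finset.univ.filter (fun x => μ Q j x ≠ 0)).card := Nat.cast_nonneg _
      have h1 : ((Finset.univ.filter (fun x => μ Q j x ≠ 0)).card : ℝ) ≤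
          (A Q j).card + (C B).card := by
        exact_mod_cast card_support_reservoirWeight_le (A Q j) (C B) (1 / (N Q * κ))
      have h2 := sum_mul_reservoirWeight_sq_le hP0 (A Q j) (C B) (1 / (N Q * κ))
      have h3 := sum_mul_reservoirWeight_ge hP0 (A Q j) (C B) (1 / (N Q * κ))
      rw [hPC B _ subset_rfl] at h2 h3
      rw [hPC Q _ (Finset.filter_subset _ _)] at h2
      have h4 := mul_pos (hc0 Q) hpB
      have h5 : 0 ≤ ∑ x, P x * (μ Q j x) ^ 2 :=
        Finset.sum_nonneg fun x _ => mul_nonneg (hP0 x) (sq_nonneg _)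
      exact div_le_div₀ (mul_nonneg (h0.trans h1) (h5.trans h2))
        (mul_le_mul h1 h2 h5 (h0.trans h1)) h4 h3
    · rw [hNK Q hQ]
      exact (Nat.ceil_lt_add_one (one_div_pos.2 haw).le).le
    · rw [hNK Q hQ]
      exact Nat.le_ceil _
    · intro j
      have h1 : ((A Q j).card : ℝ) ≤ (((C Q).card / N Q + 1 : ℕ) : ℝ) := by
        exact_mod_cast hcol Q j
      push_cast at h1
      exact h1.trans (add_le_add_left Nat.cast_div_le 1)
    · rw [← Nat.cast_sum]
      congr 1
      exact (Finset.card_eq_sum_card_fiberwise (fun x _ => Finset.mem_coe.2 (Finset.mem_univ _))).symm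
  have hcost : ∑ Q ∈ K, ∑ j, ((Finset.univ.filter (fun x => μ Q j x ≠ 0)).card : ℝ) *
      (∑ x, P x * (μ Q j x) ^ 2) / (∑ x, P x * μ Q j x) ≤
      8 * (Fintype.card τ : ℝ) ^ 3 * E := by
    refine (Finset.sum_le_sum hcostQ).trans ?_
    have hKsum : ∑ Q ∈ K, ((C Q).card : ℝ) * w Q ≤ 1 := by
      rw [← htot]
      exact Finset.sum_le_sum_of_subset_of_nonneg (Finset.subset_univ _)
        (fun Q _ _ => mul_nonneg (Nat.cast_nonneg _) (hw Q).le)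
    exact sum_class_cost_le K hKsum hκT hE0 (by linarith) hpB
      (by rwa [div_le_iff₀' hT0] at hB) (hE B hBθ)
  have hmiss : 1 - ∑ Q ∈ K, ∑ j, ∑ x, P x * μ Q j x ≤ Fintype.card τ * θ := by
    have h1 : ∑ Q ∈ K, ∑ j, ∑ x, P x * μ Q j x = ∑ x, P x * if t x ∈ K then 1 else 0 := by
      rw [Finset.sum_congr rfl fun Q _ => Finset.sum_comm, Finset.sum_comm]
      simp_rw [← hμsum, Finset.mul_sum]
    have h2 : 1 - ∑ x, P x * (if t x ∈ K then 1 else 0)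
        = ∑ Q, if Q ∈ K then 0 else ((C Q).card : ℝ) * w Q := by
      nth_rewrite 1 [← hP1]
      rw [← Finset.sum_sub_distrib, hfib]
      refine Finset.sum_congr rfl fun Q _ => ?_
      rw [← hPC Q _ subset_rfl]
      split_ifs with hQ
      · exact Finset.sum_eq_zero fun x hx => by rw [(hmemC x Q).1 hx]; simp [hQ]
      · exact Finset.sum_congr rfl fun x hx => by rw [(hmemC x Q).1 hx]; simp [hQ]
    rw [h1, h2]
    calc _ ≤ ∑ _Q : τ, θ := by
          refine Finset.sum_le_sum fun Q _ => ?_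
          split_ifs with hQ
          · exact hθ.le
          · simp only [hK, Finset.mem_filter, Finset.mem_univ, true_and, not_le] at hQ
            exact hQ.le
      _ = Fintype.card τ * θ := by simp
  have hreindex : ∀ F : (Q : τ) → Fin (N Q) → ℝ,
      ∑ i, F ((Fintype.equivFin (Σ Q : K, Fin (N Q))).symm i).1
        ((Fintype.equivFin (Σ Q : K, Fin (N Q))).symm i).2 = ∑ Q ∈ K, ∑ j, F Q j := by
    intro F
    rw [Equiv.sum_comp (Fintype.equivFin (Σ Q : K, Fin (N Q))).symm (fun ω => F ω.1 ω.2),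
      Fintype.sum_sigma]
    exact Finset.sum_coe_sort K fun Q => ∑ j, F Q j
  refine ⟨Fintype.card (Σ Q : K, Fin (N Q)),
    fun i => μ ((Fintype.equivFin (Σ Q : K, Fin (N Q))).symm i).1
      ((Fintype.equivFin (Σ Q : K, Fin (N Q))).symm i).2,
    fun _ _ => hμ0 _ _ _, fun x => ?_, fun _ => hpos _ _, ?_, ?_⟩
  · rw [hreindex fun Q j => μ Q j x, hμsum]
    split_ifs <;> norm_num
  · exact (hreindex fun Q j => ((Finset.univ.filter (fun x => μ Q j x ≠ 0)).card : ℝ) *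
      (∑ x, P x * (μ Q j x) ^ 2) / (∑ x, P x * μ Q j x)).trans_le hcost
  · rw [hreindex fun Q j => ∑ x, P x * μ Q j x]
    exact hmiss

/-- The type of a string over `Fin (e + 1)`: the number of occurrences of each nonzero letter. -/
noncomputable def stringType {e n : ℕ} (x : Fin n → Fin (e + 1)) (i : Fin e) : Fin (n + 1) :=
  ⟨(Finset.univ.filter (fun k => x k = i.succ)).card,
    Nat.lt_succ_of_le ((Finset.card_le_univ _).trans_eq (Fintype.card_fin n))⟩

/-- The probability of a string only depends on its type. -/
theorem prodP_eq_stringType {e n : ℕ} (p : Fin (e + 1) → ℝ) (x : Fin n → Fin (e + 1)) :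
    prodP p x = p 0 ^ (n - ∑ i, (stringType x i : ℕ)) *
      ∏ i : Fin e, p i.succ ^ (stringType x i : ℕ) := by
  have h : prodP p x = ∏ i, p i ^ (Finset.univ.filter (fun k => x k = i)).card := by
    unfold prodP
    rw [← Finset.prod_fiberwise Finset.univ x]
    refine Finset.prod_congr rfl fun i _ => ?_
    rw [Finset.prod_congr rfl (g := fun _ => p i)
      (fun k hk => by rw [(Finset.mem_filter.1 hk).2]), Finset.prod_const]
  have hc : ∑ i, (Finset.univ.filter (fun k => x k = i)).card = n := by
    have := Finset.card_eq_sum_card_fiberwise (s := (Finset.univ : Finset (Fin n)))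
      (t := Finset.univ) (f := x) (fun k _ => Finset.mem_coe.2 (Finset.mem_univ _))
    simpa using this.symm
  rw [h, Fin.prod_univ_succ]
  rw [Fin.sum_univ_succ] at hc
  have h0 : (Finset.univ.filter (fun k => x k = 0)).card
      = n - ∑ i, (stringType x i : ℕ) := by
    have : ∑ i, (stringType x i : ℕ)
        = ∑ i : Fin e, (Finset.univ.filter (fun k => x k = i.succ)).card := rfl
    omega
  rw [h0]
  rfl

theorem sum_prodP_rpow {d n : ℕ} {p : Fin d → ℝ} (hp : ∀ i, 0 ≤ p i) (α : ℝ) :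
    ∑ x : Fin n → Fin d, prodP p x ^ α = (∑ i, p i ^ α) ^ n := by
  rw [Fintype.sum_pow]
  refine Finset.sum_congr rfl fun x _ => ?_
  exact (Real.finsetProd_rpow _ _ (fun k _ => hp _) α).symm

/-- A set of `c` equiprobable strings of total probability at least `exp (-n r)` satisfies
`c * P^n ≤ exp (-n f(s))` for the Rényi exponent `f(s)`, for all `s ∈ [0, 1)`. -/
theorem card_mul_prob_le {d n : ℕ} (hn : 0 < n) {p : Fin d → ℝ} (hpos : ∀ i, 0 < p i) (r : ℝ)
    (S : Finset (Fin n → Fin d)) {q : ℝ} (hq : 0 < q) (hS : ∀ x ∈ S, prodP p x = q)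
    (hr : Real.exp (-(n : ℝ) * r) ≤ S.card * q) :
    (S.card : ℝ) * (S.card * q) ≤ Real.exp (-(n : ℝ) *
      ⨆ s : Set.Ico (0 : ℝ) 1,
        (-2 * (s : ℝ) / (1 - (s : ℝ))) * r - renyiH p ((1 + (s : ℝ)) / 2)) := by
  have hn' : (0 : ℝ) < n := by exact_mod_cast hn
  have ha : (0 : ℝ) < S.card := pos_of_mul_pos_left ((Real.exp_pos _).trans_le hr) hq.le
  have hr' : -(n : ℝ) * r ≤ Real.log S.card + Real.log q := by
    rw [← Real.log_mul ha.ne' hq.ne', Real.le_log_iff_exp_le (by positivity)]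
    exact hr
  rw [← Real.log_le_iff_le_exp (by positivity), Real.log_mul ha.ne' (by positivity),
    Real.log_mul ha.ne' hq.ne']
  set L := Real.log S.card
  set l := Real.log q
  have : Nonempty (Set.Ico (0 : ℝ) 1) := ⟨⟨0, by simp⟩⟩
  have hsup : (⨆ s : Set.Ico (0 : ℝ) 1,
      (-2 * (s : ℝ) / (1 - (s : ℝ))) * r - renyiH p ((1 + (s : ℝ)) / 2)) ≤ -(L + (L + l)) / n := by
    refine ciSup_le ?_
    rintro ⟨s, hs0, hs1⟩
    have hs : 0 < 1 - s := by linarith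
    have hZ : L + (1 + s) / 2 * l ≤ n * Real.log (∑ i, p i ^ ((1 + s) / 2)) := by
      have h1 : S.card * q ^ ((1 + s) / 2) ≤ (∑ i, p i ^ ((1 + s) / 2)) ^ n := by
        rw [← sum_prodP_rpow fun i => (hpos i).le]
        calc S.card * q ^ ((1 + s) / 2) = ∑ x ∈ S, prodP p x ^ ((1 + s) / 2) := by
              rw [Finset.sum_congr rfl fun x hx => by rw [hS x hx]]
              simp
          _ ≤ _ := Finset.sum_le_sum_of_subset_of_nonneg (Finset.subset_univ _)
              (fun x _ _ => Real.rpow_nonneg (Finset.prod_nonneg fun k _ => (hpos _).le) _)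
      have h2 : 0 < S.card * q ^ ((1 + s) / 2) := by positivity
      have h3 := Real.log_le_log h2 h1
      rwa [Real.log_pow, Real.log_mul ha.ne' (by positivity), Real.log_rpow hq] at h3
    have hren : renyiH p ((1 + s) / 2)
        = 2 / (1 - s) * Real.log (∑ i, p i ^ ((1 + s) / 2)) := by
      unfold renyiH
      congr 1
      have : 1 - (1 + s) / 2 = (1 - s) / 2 := by ring
      rw [this]
      field_simp
    simp only [hren]
    rw [le_div_iff₀ hn']
    set Z := Real.log (∑ i, p i ^ ((1 + s) / 2))
    have e : (-2 * s / (1 - s) * r - 2 / (1 - s) * Z) * n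
        = (2 * s * (-(n : ℝ) * r) - 2 * (n * Z)) / (1 - s) := by
      field_simp
    rw [e, div_le_iff₀ hs]
    nlinarith [mul_le_mul_of_nonneg_left hr' hs0]
  have := mul_le_mul_of_nonneg_left hsup hn'.le
  rw [mul_div_cancel₀ _ hn'.ne'] at this
  linarith

theorem stmt11 {d : ℕ} (hd : 2 ≤ d) (p : Fin d → ℝ)
    (hpos : ∀ i, 0 < p i) (hsum : ∑ i, p i = 1)
    (hnonunif : ∃ i j, p i ≠ p j)
    (r : ℝ) (hr0 : 0 < r) (hr1 : r < relEnt (pHalf p) p) :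
    ∃ N : ℕ, ∀ n ≥ N, ∃ (M : ℕ) (m : Fin M → (Fin n → Fin d) → ℝ),
      IsWeighting m ∧
      (∀ j, 0 < ∑ x, prodP p x * m j x) ∧
      (∑ j, suppCard (m j) * (∑ x, prodP p x * (m j x) ^ 2) / (∑ x, prodP p x * m j x)
        ≤ 8 * d * ((n : ℝ) + 1) ^ (3 * (d - 1)) *
          Real.exp (-(n : ℝ) *
            ⨆ s : Set.Ico (0 : ℝ) 1,
              (-2 * (s : ℝ) / (1 - (s : ℝ))) * r - renyiH p ((1 + (s : ℝ)) / 2))) ∧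
      (1 - ∑ j, ∑ x, prodP p x * m j x ≤ ((n : ℝ) + 1) ^ (d - 1) * Real.exp (-(n : ℝ) * r)) := by
  obtain ⟨e, rfl⟩ : ∃ e, d = e + 1 := ⟨d - 1, by omega⟩
  refine ⟨1, fun n hn => ?_⟩
  set w : (Fin e → Fin (n + 1)) → ℝ := fun c =>
    p 0 ^ (n - ∑ i, (c i : ℕ)) * ∏ i : Fin e, p i.succ ^ (c i : ℕ) with hw
  have hw0 : ∀ c, 0 < w c := fun c =>
    mul_pos (pow_pos (hpos _) _) (Finset.prod_pos fun i _ => pow_pos (hpos _) _)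
  have hPw : ∀ x : Fin n → Fin (e + 1), prodP p x = w (stringType x) :=
    fun x => prodP_eq_stringType p x
  have hP1 : ∑ x : Fin n → Fin (e + 1), prodP p x = 1 := by
    simpa [hsum] using sum_prodP_rpow (n := n) (fun i => (hpos i).le) 1
  obtain ⟨M, m, hm0, hm1, hmpos, hcost, hmiss⟩ := exists_cheap_weighting
    (fun x : Fin n → Fin (e + 1) => stringType x) (prodP p) w hw0 hPw hP1
    (Real.exp_pos (-(n : ℝ) * r)) (Real.exp_pos _).le
    (fun Q hQ => card_mul_prob_le hn hpos r _ (hw0 Q)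
      (fun x hx => by rw [hPw, (Finset.mem_filter.1 hx).2]) hQ)
  have hcard : (Fintype.card (Fin e → Fin (n + 1)) : ℝ) = ((n : ℝ) + 1) ^ e := by simp
  rw [hcard] at hcost hmiss
  refine ⟨M, m, ⟨hm0, fun j x => ?_, hm1⟩, hmpos, ?_, by simpa using hmiss⟩
  · exact (Finset.single_le_sum (fun i _ => hm0 i x) (Finset.mem_univ j)).trans (hm1 x)
  · refine hcost.trans ?_
    rw [Nat.add_sub_cancel, ← pow_mul, mul_comm e 3]
    have hd1 : (1 : ℝ) ≤ ((e + 1 : ℕ) : ℝ) := by exact_mod_cast Nat.succ_pos e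
    gcongr
    linarith
end

section
/- Let d ≥ 2 and let p = (p_1,…,p_d) be a non-uniform probability distribution with all p_i > 0. For every ε ∈ (0,1) there exist a constant C and an integer N such that for each n ≥ N there is a weighting collection {m_j}_{j=1,…,M_n} on {1,…,d}^n, with Σ_{x⃗} P^n(x⃗) m_j(x⃗) > 0 for each j, satisfying: (i) log [ Σ_{j=1}^{M_n} |supp m_j| · ( Σ_{x⃗} P^n(x⃗) m_j(x⃗)² ) / ( Σ_{x⃗} P^n(x⃗) m_j(x⃗) ) ] ≤ n·H(p) + √n·√V(p)·Φ^{−1}(ε) − log n + C, and (ii) Σ_{j=1}^{M_n} Σ_{x⃗} P^n(x⃗) m_j(x⃗) → ε as n → ∞. -/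
open scoped BigOperators Classical
open Real

/-- Shannon entropy (natural log). -/
noncomputable def shannonH {d : ℕ} (p : Fin d → ℝ) : ℝ :=
  -∑ i, p i * Real.log (p i)

/-- Varentropy `V(p)`. -/
noncomputable def varH {d : ℕ} (p : Fin d → ℝ) : ℝ :=
  ∑ i, p i * (Real.log (p i) + shannonH p) ^ 2

/-- CDF of the standard normal distribution. -/
noncomputable def Phi (x : ℝ) : ℝ :=
  ∫ y in Set.Iic x, Real.exp (-(y ^ 2) / 2) / Real.sqrt (2 * Real.pi)

/-- Inverse of the standard normal CDF. -/
noncomputable def PhiInv : ℝ → ℝ := Function.invFun Phi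

open MeasureTheory ProbabilityTheory Filter Topology

/-- `Phi` is the distribution function of the standard Gaussian measure. -/
lemma Phi_eq_cdf : Phi = cdf (gaussianReal 0 1) := by
  funext x
  rw [cdf_eq_real, measureReal_def, gaussianReal_apply_eq_integral _ one_ne_zero,
    ENNReal.toReal_ofReal (integral_nonneg fun y => gaussianPDFReal_nonneg 0 1 y), Phi]
  refine integral_congr_ae (ae_of_all _ fun y => ?_)
  simp [gaussianPDFReal, div_eq_inv_mul]

lemma continuous_Phi : Continuous Phi := by
  have hint : Integrable (fun y : ℝ => Real.exp (-(y ^ 2) / 2) / Real.sqrt (2 * Real.pi)) := by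
    refine (integrable_gaussianPDFReal 0 1).congr (ae_of_all _ fun y => ?_)
    simp [gaussianPDFReal, div_eq_inv_mul]
  have key : Phi = fun x => Phi 0 +
      ∫ y in (0 : ℝ)..x, Real.exp (-(y ^ 2) / 2) / Real.sqrt (2 * Real.pi) := by
    funext x
    rw [← intervalIntegral.integral_Iic_sub_Iic hint.integrableOn hint.integrableOn]
    simp [Phi]
  rw [key]
  exact continuous_const.add
    (intervalIntegral.continuous_primitive (fun _ _ => hint.intervalIntegrable) 0)

lemma Phi_PhiInv {ε : ℝ} (hε : ε ∈ Set.Ioo (0 : ℝ) 1) : Phi (PhiInv ε) = ε := by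
  refine Function.invFun_eq (mem_range_of_exists_le_of_exists_ge continuous_Phi ?_ ?_)
  · rw [Phi_eq_cdf]
    exact ((tendsto_cdf_atBot _).eventually (eventually_le_nhds hε.1)).exists
  · rw [Phi_eq_cdf]
    exact ((tendsto_cdf_atTop _).eventually (eventually_ge_nhds hε.2)).exists

lemma prodP_pos {d n : ℕ} {p : Fin d → ℝ} (hpos : ∀ i, 0 < p i) (x : Fin n → Fin d) :
    0 < prodP p x :=
  Finset.prod_pos fun _ _ => hpos _

lemma sum_prodP {d : ℕ} {p : Fin d → ℝ} (hsum : ∑ i, p i = 1) (n : ℕ) :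
    ∑ x : Fin n → Fin d, prodP p x = 1 := by
  simp only [prodP]
  rw [← Fintype.sum_pow, hsum, one_pow]

/-- Central limit theorem for a distribution on a finite alphabet, with a vanishing shift `δ`. -/
lemma tendsto_sum_prodP_of_standardized {d : ℕ} {p : Fin d → ℝ}
    (hpos : ∀ i, 0 < p i) (hsum : ∑ i, p i = 1) {f : Fin d → ℝ}
    (hf0 : ∑ i, p i * f i = 0) (hf1 : ∑ i, p i * f i ^ 2 = 1)
    {δ : ℕ → ℝ} (hδ : Tendsto δ atTop (𝓝 0)) (a : ℝ) :
    Tendsto (fun n : ℕ => ∑ x : Fin n → Fin d, prodP p x *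
      if (√n)⁻¹ * ∑ k, f (x k) + δ n ≤ a then 1 else 0) atTop (𝓝 (Phi a)) := by
  let q : PMF (Fin d) := PMF.ofFintype (fun i => ENNReal.ofReal (p i)) (by
    rw [← ENNReal.ofReal_sum_of_nonneg fun i _ => (hpos i).le, hsum, ENNReal.ofReal_one])
  let ν : Measure (Fin d) := q.toMeasure
  have hν (g : Fin d → ℝ) : ∫ i, g i ∂ν = ∑ i, p i * g i := by
    rw [PMF.integral_eq_sum]
    exact Finset.sum_congr rfl fun i _ => by simp [q, ENNReal.toReal_ofReal (hpos i).le]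
  have hν1 (i : Fin d) : ν.real {i} = p i := by
    rw [measureReal_def, PMF.toMeasure_apply_singleton _ _ (MeasurableSet.singleton _)]
    simp [q, ENNReal.toReal_ofReal (hpos i).le]
  let P : Measure (ℕ → Fin d) := Measure.infinitePi fun _ => ν
  have hmf : Measurable f := measurable_of_finite f
  have hlaw (k : ℕ) : P.map (fun ω => ω k) = ν := Measure.infinitePi_map_eval _ k
  have hexp (g : Fin d → ℝ) : ∫ ω, g (ω 0) ∂P = ∑ i, p i * g i := by
    rw [← hν, ← hlaw 0, integral_map (measurable_pi_apply 0).aemeasurable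
      (measurable_of_finite g).aestronglyMeasurable]
  have hclt := tendstoInDistribution_inv_sqrt_mul_sum (P := P) (P' := gaussianReal 0 1)
    (X := fun k ω => f (ω k)) (Y := id) ⟨aemeasurable_id, Measure.map_id⟩
    ((hexp f).trans hf0) ((hexp fun i => f i ^ 2).trans hf1)
    (iIndepFun_infinitePi (X := fun _ => f) fun _ => hmf)
    (fun k => IdentDistrib.comp (f := fun ω : ℕ → Fin d => ω k) (g := fun ω : ℕ → Fin d => ω 0)
      ⟨(measurable_pi_apply k).aemeasurable, (measurable_pi_apply 0).aemeasurable, by rw [hlaw, hlaw]⟩ hmf)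
  have hshift : TendstoInMeasure P (fun n (_ : ℕ → Fin d) => δ n) atTop (fun _ => (0 : ℝ)) :=
    tendstoInMeasure_of_tendsto_ae (fun _ => aestronglyMeasurable_const)
      (ae_of_all _ fun _ => hδ)
  have hsl := hclt.add_of_tendstoInMeasure_const hshift fun _ => aemeasurable_const
  have hlim := ProbabilityMeasure.tendsto_measure_of_null_frontier_of_tendsto hsl.tendsto
    (E := Set.Iic a) (by
      have := nullSingletonClass_gaussianReal (μ := 0) (v := 1) one_ne_zero
      simp)
  convert! NNReal.tendsto_coe.2 hlim using 1
  · funext n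
    have hpi : P.map (fun ω (k : Fin n) => ω k) = Measure.pi fun _ => ν := by
      rw [← Measure.infinitePi_eq_pi]
      exact Measure.map_infinitePi_infinitePi_of_inj (P := fun _ : ℕ => ν) Fin.val_injective
    have hsingle (x : Fin n → Fin d) : (Measure.pi fun _ => ν).real {x} = prodP p x := by
      rw [measureReal_def, Measure.pi_singleton, ENNReal.toReal_prod]
      exact Finset.prod_congr rfl fun k _ => hν1 (x k)
    let S : Finset (Fin n → Fin d) :=
      Finset.univ.filter fun x => (√n)⁻¹ * ∑ k, f (x k) + δ n ≤ a
    change _ = (P.map _).real (Set.Iic a)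
    have hpre : ((fun ω : ℕ → Fin d => (√n)⁻¹ * ∑ k ∈ Finset.range n, f (ω k)) +
        fun _ => δ n) ⁻¹' Set.Iic a = (fun ω (k : Fin n) => ω k) ⁻¹' (S : Set (Fin n → Fin d)) := by
      ext ω
      simp [S, Finset.sum_range]
    rw [map_measureReal_apply_of_aemeasurable (hsl.forall_aemeasurable n) measurableSet_Iic, hpre,
      ← map_measureReal_apply (by fun_prop) S.measurableSet, hpi,
      ← sum_measureReal_singleton]
    simp [S, hsingle, Finset.sum_filter]
  · change 𝓝 _ = 𝓝 ((Measure.map _ _).real (Set.Iic a))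
    simp [Phi_eq_cdf, cdf_eq_real]

/-- A set of strings of probability at least `c` each has at most `c⁻¹` elements. -/
lemma card_le_of_le_prodP {d n : ℕ} {p : Fin d → ℝ} (hpos : ∀ i, 0 < p i) (hsum : ∑ i, p i = 1)
    {S : Finset (Fin n → Fin d)} {t : ℝ} (hS : ∀ x ∈ S, Real.exp (-t) ≤ prodP p x) :
    (S.card : ℝ) ≤ Real.exp t := by
  have h : S.card * Real.exp (-t) ≤ 1 := by
    rw [← nsmul_eq_mul, ← sum_prodP hsum n]
    exact (Finset.card_nsmul_le_sum _ _ _ hS).trans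
      (Finset.sum_le_univ_sum_of_nonneg fun x => (prodP_pos hpos x).le)
  rwa [Real.exp_neg, ← div_eq_mul_inv, div_le_one (Real.exp_pos t)] at h

lemma varH_pos {d : ℕ} {p : Fin d → ℝ} (hpos : ∀ i, 0 < p i) (hnonunif : ∃ i j, p i ≠ p j) :
    0 < varH p := by
  obtain ⟨i, j, hij⟩ := hnonunif
  have hnonneg (k : Fin d) : 0 ≤ p k * (Real.log (p k) + shannonH p) ^ 2 :=
    mul_nonneg (hpos k).le (sq_nonneg _)
  refine (Finset.sum_nonneg fun k _ => hnonneg k).lt_of_ne' fun h => hij ?_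
  have hlog (k : Fin d) : Real.log (p k) = -shannonH p := by
    have hk := (Finset.sum_eq_zero_iff_of_nonneg fun k _ => hnonneg k).1 h k (Finset.mem_univ k)
    have := pow_eq_zero_iff two_ne_zero |>.1 ((mul_eq_zero.1 hk).resolve_left (hpos k).ne')
    linarith
  exact Real.log_injOn_pos (hpos i) (hpos j) ((hlog i).trans (hlog j).symm)

lemma tendsto_log_div_sqrt_mul (v : ℝ) :
    Tendsto (fun n : ℕ => Real.log n / (√n * v)) atTop (𝓝 0) := by
  have h : Tendsto (fun n : ℕ => Real.log n / √n) atTop (𝓝 0) := by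
    simp_rw [Real.sqrt_eq_rpow]
    exact (isLittleO_log_rpow_atTop (by norm_num : (0 : ℝ) < 1 / 2)).tendsto_div_nhds_zero.comp
      tendsto_natCast_atTop_atTop
  simpa [div_mul_eq_div_div] using h.div_const v

theorem stmt13 {d : ℕ} (hd : 2 ≤ d) (p : Fin d → ℝ)
    (hpos : ∀ i, 0 < p i) (hsum : ∑ i, p i = 1)
    (hnonunif : ∃ i j, p i ≠ p j)
    (ε : ℝ) (hε : ε ∈ Set.Ioo (0 : ℝ) 1) :
    ∃ (C : ℝ) (N : ℕ) (M : ℕ → ℕ) (m : ∀ n : ℕ, Fin (M n) → (Fin n → Fin d) → ℝ),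
      (∀ n ≥ N,
        IsWeighting (m n) ∧
        (∀ j, 0 < ∑ x, prodP p x * m n j x) ∧
        Real.log (∑ j, suppCard (m n j) * (∑ x, prodP p x * (m n j x) ^ 2) /
              (∑ x, prodP p x * m n j x))
          ≤ (n : ℝ) * shannonH p + Real.sqrt n * Real.sqrt (varH p) * PhiInv ε
            - Real.log n + C) ∧
      Filter.Tendsto (fun n : ℕ => ∑ j, ∑ x, prodP p x * m n j x)
        Filter.atTop (nhds ε) := by
  set v := √(varH p) with hv
  have hV := varH_pos hpos hnonunif
  have hv0 : 0 < v := Real.sqrt_pos.2 hV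
  set a := PhiInv ε
  let f : Fin d → ℝ := fun i => -(Real.log (p i) + shannonH p) / v
  have hf0 : ∑ i, p i * f i = 0 := by
    have h (i : Fin d) : p i * f i = -(p i * Real.log (p i) + p i * shannonH p) / v := by
      simp only [f]; ring
    simp_rw [h]
    rw [← Finset.sum_div, Finset.sum_neg_distrib, Finset.sum_add_distrib, ← Finset.sum_mul, hsum,
      shannonH]
    simp
  have hf1 : ∑ i, p i * f i ^ 2 = 1 := by
    have h (i : Fin d) : p i * f i ^ 2 = p i * (Real.log (p i) + shannonH p) ^ 2 / varH p := by
      simp only [f]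
      rw [div_pow, neg_sq, hv, Real.sq_sqrt hV.le, mul_div_assoc]
    simp_rw [h]
    rw [← Finset.sum_div]
    exact div_self hV.ne'
  let good (n : ℕ) (x : Fin n → Fin d) : Prop :=
    (√n)⁻¹ * ∑ k, f (x k) + Real.log n / (√n * v) ≤ a
  have hlim : Tendsto (fun n : ℕ => ∑ x : Fin n → Fin d, prodP p x * if good n x then 1 else 0)
      atTop (𝓝 ε) := by
    have := tendsto_sum_prodP_of_standardized hpos hsum hf0 hf1 (tendsto_log_div_sqrt_mul v) a
    rwa [Phi_PhiInv hε] at this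
  obtain ⟨N, hN⟩ := eventually_atTop.1 (hlim.eventually (lt_mem_nhds hε.1))
  refine ⟨0, max N 1, fun _ => 1, fun n _ x => if good n x then 1 else 0, fun n hn => ?_, ?_⟩
  · have hmass := hN n (le_of_max_le_left hn)
    have hn0 : (0 : ℝ) < n := by exact_mod_cast le_of_max_le_right hn
    refine ⟨⟨fun _ x => ?_, fun _ x => ?_, fun x => ?_⟩, fun _ => hmass, ?_⟩
    · dsimp only; split_ifs <;> norm_num
    · dsimp only; split_ifs <;> norm_num
    · simp only [Finset.univ_unique, Finset.sum_singleton]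
      split_ifs <;> norm_num
    · set t := n * shannonH p + √n * v * a - Real.log n
      have hsq (x : Fin n → Fin d) :
          (if good n x then (1 : ℝ) else 0) ^ 2 = if good n x then 1 else 0 := by
        split_ifs <;> norm_num
      simp only [Finset.univ_unique, Finset.sum_singleton, hsq, mul_div_assoc, div_self hmass.ne',
        mul_one, add_zero]
      have hcard : suppCard (fun x : Fin n → Fin d => if good n x then (1 : ℝ) else 0) ≤
          Real.exp t := by
        refine card_le_of_le_prodP hpos hsum fun x hx => ?_
        have hgood : good n x := by simpa using hx
        rw [← Real.le_log_iff_exp_le (prodP_pos hpos x), prodP,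
          Real.log_prod fun k _ => (hpos _).ne']
        have hs : 0 < √(n : ℝ) := Real.sqrt_pos.2 hn0
        have hfs : v * ∑ k, f (x k) = -(∑ k, Real.log (p (x k)) + n * shannonH p) := by
          simp only [f]
          rw [← Finset.sum_div, mul_div_cancel₀ _ hv0.ne', Finset.sum_neg_distrib,
            Finset.sum_add_distrib]
          simp
        have hbound := mul_le_mul_of_nonneg_left hgood (mul_pos hs hv0).le
        have hexpand : √n * v * ((√n)⁻¹ * ∑ k, f (x k) + Real.log n / (√n * v)) =
            v * ∑ k, f (x k) + Real.log n := by
          field_simp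
        linarith
      have hsupp : 0 < suppCard (fun x : Fin n → Fin d => if good n x then (1 : ℝ) else 0) := by
        refine Nat.cast_pos.2 (Finset.card_pos.2 ?_)
        obtain ⟨x, -, hx⟩ := Finset.exists_ne_zero_of_sum_ne_zero hmass.ne'
        exact ⟨x, by simpa using right_ne_zero_of_mul hx⟩
      exact (Real.log_le_iff_le_exp hsupp).2 hcard
  · simpa using hlim
end

section
/- Let p = (p_1,…,p_d) be a non-uniform probability distribution with all p_i > 0, let ε ∈ (0,1), let c > 0 (arbitrary if {log p_i} is non-lattice, equal to the lattice span if it is a lattice family), and let t > 0. For k = 0,1,2,… set R_{k,n} = { x⃗ ∈ {1,…,d}^n : n·H(p) + √n·√V(p)·Φ^{−1}(ε) − ck ≥ −log P^n(x⃗) > n·H(p) + √n·√V(p)·Φ^{−1}(ε) − c(k+1) }, and let P^n(R_{k,n}) = Σ_{x⃗∈R_{k,n}} P^n(x⃗). Then there exist a constant C and an integer N such that for all n ≥ N, | log ( max_{0 ≤ k ≤ ⌊tn⌋} P^n(R_{k,n}) ) + (1/2)·log n | ≤ C. -/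
open scoped BigOperators Classical
open Real

/-- `c₀` is the lattice span of the family `{log p_i}`: the largest positive real
such that all differences `log p_i − log p_j` lie in `c₀ ⬝ ℤ`. -/
def IsLatticeSpan {d : ℕ} (p : Fin d → ℝ) (c₀ : ℝ) : Prop :=
  0 < c₀ ∧ (∀ i j, ∃ k : ℤ, Real.log (p i) - Real.log (p j) = (k : ℝ) * c₀) ∧
    ∀ c' : ℝ, 0 < c' →
      (∀ i j, ∃ k : ℤ, Real.log (p i) - Real.log (p j) = (k : ℝ) * c') → c' ≤ c₀

/-- The slab `R_{k,n}` of strings whose self-information lies in the `k`-th window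
of width `c` below `n·H(p) + √n·√V(p)·Φ⁻¹(ε)`. -/
noncomputable def Rslab {d : ℕ} (p : Fin d → ℝ) (ε c : ℝ) (n k : ℕ) :
    Finset (Fin n → Fin d) :=
  Finset.univ.filter (fun x =>
    -Real.log (prodP p x)
        ≤ (n : ℝ) * shannonH p + Real.sqrt n * Real.sqrt (varH p) * PhiInv ε - c * k
      ∧ (n : ℝ) * shannonH p + Real.sqrt n * Real.sqrt (varH p) * PhiInv ε - c * (k + 1)
        < -Real.log (prodP p x))

lemma sq_sum_cos_add_sq_sum_sin_le {ι : Type*} [Fintype ι] (p θ : ι → ℝ) (hpos : ∀ i, 0 ≤ p i)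
    (hsum : ∑ i, p i = 1) (i j : ι) :
    (∑ k, p k * cos (θ k)) ^ 2 + (∑ k, p k * sin (θ k)) ^ 2
      ≤ 1 - p i * p j * (1 - cos (θ i - θ j)) := by
  have key : ∑ a, ∑ b, p a * p b * (1 - cos (θ a - θ b)) =
      1 - ((∑ k, p k * cos (θ k)) ^ 2 + (∑ k, p k * sin (θ k)) ^ 2) := by
    have h1 : (1 : ℝ) = (∑ k, p k) * ∑ k, p k := by rw [hsum, one_mul]
    conv_rhs => rw [h1, sq, sq]
    simp only [Finset.sum_mul_sum, ← Finset.sum_add_distrib, ← Finset.sum_sub_distrib]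
    refine Finset.sum_congr rfl fun a _ => Finset.sum_congr rfl fun b _ => ?_
    rw [cos_sub]
    ring
  have hnn : ∀ a b, 0 ≤ p a * p b * (1 - cos (θ a - θ b)) := fun a b =>
    mul_nonneg (mul_nonneg (hpos a) (hpos b)) (sub_nonneg.2 (cos_le_one _))
  have hle : p i * p j * (1 - cos (θ i - θ j)) ≤ ∑ a, ∑ b, p a * p b * (1 - cos (θ a - θ b)) :=
    (Finset.single_le_sum (f := fun b => p i * p b * (1 - cos (θ i - θ b)))
      (fun b _ => hnn i b) (Finset.mem_univ j)).trans
    (Finset.single_le_sum (f := fun a => ∑ b, p a * p b * (1 - cos (θ a - θ b)))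
      (fun a _ => Finset.sum_nonneg fun b _ => hnn a b) (Finset.mem_univ i))
  linarith

lemma norm_sum_mul_cexp_le {ι : Type*} [Fintype ι] (p X : ι → ℝ) (hpos : ∀ i, 0 ≤ p i)
    (hsum : ∑ i, p i = 1) (i j : ι) (t : ℝ) (ht : |t * (X i - X j)| ≤ π) :
    ‖∑ k, (p k : ℂ) * Complex.exp ((t * X k : ℝ) * Complex.I)‖
      ≤ exp (-(p i * p j * (X i - X j) ^ 2 / π ^ 2) * t ^ 2) := by
  have hre : (∑ k, (p k : ℂ) * Complex.exp ((t * X k : ℝ) * Complex.I)).re =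
      ∑ k, p k * cos (t * X k) := by
    rw [Complex.re_sum]
    exact Finset.sum_congr rfl fun k _ => by
      rw [Complex.re_ofReal_mul, Complex.exp_ofReal_mul_I_re]
  have him : (∑ k, (p k : ℂ) * Complex.exp ((t * X k : ℝ) * Complex.I)).im =
      ∑ k, p k * sin (t * X k) := by
    rw [Complex.im_sum]
    exact Finset.sum_congr rfl fun k _ => by
      rw [Complex.im_ofReal_mul, Complex.exp_ofReal_mul_I_im]
  have h1 := sq_sum_cos_add_sq_sum_sin_le p (fun k => t * X k) hpos hsum i j
  have h2 := cos_le_one_sub_mul_cos_sq ht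
  have hpp : 0 ≤ p i * p j := mul_nonneg (hpos i) (hpos j)
  refine (sq_le_sq₀ (norm_nonneg _) (exp_pos _).le).1 ?_
  rw [Complex.sq_norm, Complex.normSq_apply, hre, him, ← sq, ← sq, ← exp_nat_mul]
  refine h1.trans ?_
  refine le_trans ?_ (add_one_le_exp _)
  rw [← mul_sub]
  have h3 : p i * p j * (2 / π ^ 2 * (t * (X i - X j)) ^ 2)
      ≤ p i * p j * (1 - cos (t * (X i - X j))) :=
    mul_le_mul_of_nonneg_left (by linarith) hpp
  have h4 : ((2 : ℕ) : ℝ) * (-(p i * p j * (X i - X j) ^ 2 / π ^ 2) * t ^ 2) =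
      -(p i * p j * (2 / π ^ 2 * (t * (X i - X j)) ^ 2)) := by
    push_cast
    ring
  rw [h4]
  linarith

lemma sum_prod_mul_cos_le {ι : Type*} [Fintype ι] (p X : ι → ℝ) (n : ℕ) (a t : ℝ) :
    ∑ x : Fin n → ι, (∏ k, p (x k)) * cos (t * ((∑ k, X (x k)) - a))
      ≤ ‖∑ k, (p k : ℂ) * Complex.exp ((t * X k : ℝ) * Complex.I)‖ ^ n := by
  have h : (∑ x : Fin n → ι, (∏ k, p (x k)) * cos (t * ((∑ k, X (x k)) - a)) : ℝ) =
      (Complex.exp ((-(t * a) : ℝ) * Complex.I) *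
        (∑ k, (p k : ℂ) * Complex.exp ((t * X k : ℝ) * Complex.I)) ^ n).re := by
    rw [Fintype.sum_pow, Finset.mul_sum, Complex.re_sum]
    refine Finset.sum_congr rfl fun x _ => ?_
    rw [Finset.prod_mul_distrib, ← Complex.exp_sum, ← Complex.ofReal_prod, mul_left_comm,
      ← Complex.exp_add, Complex.re_ofReal_mul, ← Finset.sum_mul, ← Complex.ofReal_sum, ← add_mul,
      ← Complex.ofReal_add, Complex.exp_ofReal_mul_I_re, ← Finset.mul_sum]
    congr 2
    ring
  rw [h]
  refine (Complex.re_le_norm _).trans ?_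
  rw [norm_mul, Complex.norm_exp_ofReal_mul_I, one_mul, norm_pow]

lemma integral_sub_mul_cos_nonneg (δ y : ℝ) :
    0 ≤ ∫ t in (0 : ℝ)..δ, (δ - t) * cos (t * y) := by
  rcases eq_or_ne y 0 with rfl | hy
  · have h : ∀ t ∈ Set.uIcc 0 δ,
        HasDerivAt (fun t : ℝ => δ * t - t ^ 2 / 2) ((δ - t) * cos (t * 0)) t := by
      intro t _
      have := ((hasDerivAt_id t).const_mul δ).sub (((hasDerivAt_id t).pow 2).div_const 2)
      refine (this.congr_deriv ?_ :)
      simp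
    rw [intervalIntegral.integral_eq_sub_of_hasDerivAt h
      (by apply Continuous.intervalIntegrable; fun_prop)]
    nlinarith [sq_nonneg δ]
  · have h : ∀ t ∈ Set.uIcc 0 δ,
        HasDerivAt (fun t : ℝ => (δ - t) * (sin (t * y) / y) - cos (t * y) / y ^ 2)
          ((δ - t) * cos (t * y)) t := by
      intro t _
      have hl : HasDerivAt (fun t : ℝ => t * y) y t := by
        simpa using (hasDerivAt_id t).mul_const y
      have := (((hasDerivAt_id t).const_sub δ).mul (hl.sin.div_const y)).sub
        (hl.cos.div_const (y ^ 2))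
      refine (this.congr_deriv ?_ :)
      simp only [id]
      field_simp
      ring
    rw [intervalIntegral.integral_eq_sub_of_hasDerivAt h
      (by apply Continuous.intervalIntegrable; fun_prop)]
    have h1 : cos (δ * y) / y ^ 2 ≤ 1 / y ^ 2 :=
      div_le_div_of_nonneg_right (cos_le_one _) (sq_nonneg y)
    simpa using h1

lemma le_integral_sub_mul_cos {δ y : ℝ} (hδ : 0 ≤ δ) (hy : δ * |y| ≤ 1) :
    δ ^ 2 / 4 ≤ ∫ t in (0 : ℝ)..δ, (δ - t) * cos (t * y) := by
  have hhalf : ∫ t in (0 : ℝ)..δ, (δ - t) * (1 / 2) = δ ^ 2 / 4 := by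
    rw [intervalIntegral.integral_mul_const, intervalIntegral.integral_sub (by simp) (by simp)]
    simp
    ring
  rw [← hhalf]
  refine intervalIntegral.integral_mono_on hδ
    (by apply Continuous.intervalIntegrable; fun_prop)
    (by apply Continuous.intervalIntegrable; fun_prop) fun t ht => ?_
  refine mul_le_mul_of_nonneg_left ?_ (sub_nonneg.2 ht.2)
  have h1 : |t * y| ≤ 1 := by
    rw [abs_mul, abs_of_nonneg ht.1]
    exact (mul_le_mul_of_nonneg_right ht.2 (abs_nonneg y)).trans hy
  have h2 := one_sub_sq_div_two_le_cos (x := t * y)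
  have h3 : (t * y) ^ 2 ≤ 1 := (sq_le_one_iff_abs_le_one _).2 h1
  linarith

/-- Concentration inequality for sums of independent copies of a non-constant variable. -/
lemma exists_sum_prod_le_div_sqrt {ι : Type*} [Fintype ι] (p X : ι → ℝ) (hpos : ∀ i, 0 < p i)
    (hsum : ∑ i, p i = 1) (hX : ∃ i j, X i ≠ X j) {c : ℝ} (hc : 0 < c) :
    ∃ C : ℝ, ∀ n : ℕ, 0 < n → ∀ a : ℝ, ∀ s : Finset (Fin n → ι),
      (∀ x ∈ s, |(∑ k, X (x k)) - a| ≤ c) → ∑ x ∈ s, ∏ k, p (x k) ≤ C / √n := by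
  obtain ⟨i, j, hij⟩ := hX
  have hΔ : 0 < |X i - X j| := abs_pos.2 (sub_ne_zero.2 hij)
  set δ := min (1 / c) (π / |X i - X j|) with hδ
  have hδ0 : 0 < δ := lt_min (by positivity) (by positivity)
  have hδc : δ * c ≤ 1 := by
    have : δ ≤ 1 / c := min_le_left _ _
    rwa [le_div_iff₀ hc] at this
  have hδX : δ * |X i - X j| ≤ π := by
    have : δ ≤ π / |X i - X j| := min_le_right _ _
    rwa [le_div_iff₀ hΔ] at this
  set κ := p i * p j * (X i - X j) ^ 2 / π ^ 2 with hκ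
  have hκ0 : 0 < κ := by
    have := hpos i
    have := hpos j
    have : 0 < (X i - X j) ^ 2 := by rw [← sq_abs]; positivity
    positivity
  refine ⟨4 / δ * √(π / κ), fun n hn a s hs => ?_⟩
  have hn' : (0 : ℝ) < n := by exact_mod_cast hn
  set f : ℝ → ℝ := fun y => ∫ t in (0 : ℝ)..δ, (δ - t) * cos (t * y) with hf
  have hP : ∀ x : Fin n → ι, 0 ≤ ∏ k, p (x k) := fun x => Finset.prod_nonneg fun k _ => (hpos _).le
  have h1 : (∑ x ∈ s, ∏ k, p (x k)) * (δ ^ 2 / 4)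
      ≤ ∑ x : Fin n → ι, (∏ k, p (x k)) * f ((∑ k, X (x k)) - a) := by
    rw [Finset.sum_mul]
    refine (Finset.sum_le_sum fun x hx => mul_le_mul_of_nonneg_left
      (le_integral_sub_mul_cos hδ0.le ?_) (hP x)).trans
      (Finset.sum_le_sum_of_subset_of_nonneg (Finset.subset_univ s) fun x _ _ =>
        mul_nonneg (hP x) (integral_sub_mul_cos_nonneg _ _))
    exact (mul_le_mul_of_nonneg_left (hs x hx) hδ0.le).trans hδc
  have h2 : ∑ x : Fin n → ι, (∏ k, p (x k)) * f ((∑ k, X (x k)) - a) =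
      ∫ t in (0 : ℝ)..δ, (δ - t) *
        ∑ x : Fin n → ι, (∏ k, p (x k)) * cos (t * ((∑ k, X (x k)) - a)) := by
    simp only [hf, Finset.mul_sum]
    rw [intervalIntegral.integral_finsetSum]
    · refine Finset.sum_congr rfl fun x _ => ?_
      rw [← intervalIntegral.integral_const_mul]
      refine intervalIntegral.integral_congr fun t _ => ?_
      ring
    · intro x _
      apply Continuous.intervalIntegrable
      fun_prop
  have h3 : (∫ t in (0 : ℝ)..δ, (δ - t) *
        ∑ x : Fin n → ι, (∏ k, p (x k)) * cos (t * ((∑ k, X (x k)) - a)))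
      ≤ ∫ t in (0 : ℝ)..δ, δ * exp (-(n * κ) * t ^ 2) := by
    refine intervalIntegral.integral_mono_on hδ0.le
      (by apply Continuous.intervalIntegrable; fun_prop)
      (by apply Continuous.intervalIntegrable; fun_prop) fun t ht => ?_
    have hφ := norm_sum_mul_cexp_le p X (fun i => (hpos i).le) hsum i j t (by
      rw [abs_mul, abs_of_nonneg ht.1]
      exact (mul_le_mul_of_nonneg_right ht.2 (abs_nonneg _)).trans hδX)
    have hb : ∑ x : Fin n → ι, (∏ k, p (x k)) * cos (t * ((∑ k, X (x k)) - a))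
        ≤ exp (-(n * κ) * t ^ 2) := by
      refine (sum_prod_mul_cos_le p X n a t).trans ((pow_le_pow_left₀ (norm_nonneg _) hφ n).trans ?_)
      rw [← exp_nat_mul, ← hκ]
      refine le_of_eq (congrArg exp ?_)
      ring
    exact (mul_le_mul_of_nonneg_left hb (sub_nonneg.2 ht.2)).trans
      (mul_le_mul_of_nonneg_right (by linarith [ht.1]) (exp_pos _).le)
  have h4 : ∫ t in (0 : ℝ)..δ, δ * exp (-(n * κ) * t ^ 2) ≤ δ * √(π / (n * κ)) := by
    rw [intervalIntegral.integral_const_mul, ← integral_gaussian,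
      intervalIntegral.integral_of_le hδ0.le]
    exact mul_le_mul_of_nonneg_left (MeasureTheory.setIntegral_le_integral
      (integrable_exp_neg_mul_sq (by positivity))
      (Filter.Eventually.of_forall fun t => (exp_pos _).le)) hδ0.le
  have h5 : √(π / (n * κ)) = √(π / κ) / √n := by
    rw [← sqrt_div' _ hn'.le, div_div, mul_comm κ]
  rw [h5] at h4
  have h6 : (∑ x ∈ s, ∏ k, p (x k)) * (δ ^ 2 / 4) ≤ δ * (√(π / κ) / √n) := by linarith
  have h7 : 4 / δ * √(π / κ) / √n = δ * (√(π / κ) / √n) / (δ ^ 2 / 4) := by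
    field_simp
  rw [h7, le_div_iff₀ (by positivity)]
  exact h6

open MeasureTheory ProbabilityTheory Filter in
/-- A lower bound on the scale of the central limit theorem for finitely supported variables. -/
lemma exists_eventually_le_sum_prod {ι : Type*} [Fintype ι] (p X : ι → ℝ)
    (hpos : ∀ i, 0 < p i) (hsum : ∑ i, p i = 1) (hX : ∃ i j, X i ≠ X j) (z : ℝ) :
    ∃ δ : ℝ, 0 < δ ∧ ∀ᶠ n : ℕ in atTop,
      δ ≤ ∑ x : Fin n → ι with (√n)⁻¹ * ((∑ k, X (x k)) - n * ∑ i, p i * X i) ∈ Set.Ioo (z - 1) z,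
        ∏ k, p (x k) := by
  let : MeasurableSpace ι := ⊤
  have : DiscreteMeasurableSpace ι := ⟨fun _ => trivial⟩
  let ν : Measure ι := (PMF.ofFintype (fun i => ENNReal.ofReal (p i)) (by
    rw [← ENNReal.ofReal_sum_of_nonneg fun i _ => (hpos i).le, hsum, ENNReal.ofReal_one])).toMeasure
  have hν (i : ι) : ν {i} = ENNReal.ofReal (p i) := by
    rw [PMF.toMeasure_apply_singleton _ _ (measurableSet_singleton i), PMF.ofFintype_apply]
  have : IsProbabilityMeasure ν := PMF.toMeasure.isProbabilityMeasure _
  let P : Measure (ℕ → ι) := Measure.infinitePi fun _ => ν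
  let Y : ℕ → (ℕ → ι) → ℝ := fun k ω => X (ω k)
  have hXm : Measurable X := measurable_from_top
  have hYm (k : ℕ) : Measurable (Y k) := hXm.comp (measurable_pi_apply k)
  have hmap (k : ℕ) : P.map (fun ω => ω k) = ν := Measure.infinitePi_map_eval _ k
  have hindep : iIndepFun Y P := iIndepFun_infinitePi (X := fun _ => X) fun _ => hXm
  have hident (k : ℕ) : IdentDistrib (Y k) (Y 0) P P := by
    have h : IdentDistrib (fun ω : ℕ → ι => ω k) (fun ω => ω 0) P P :=
      ⟨(measurable_pi_apply k).aemeasurable, (measurable_pi_apply 0).aemeasurable, by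
        rw [hmap, hmap]⟩
    exact h.comp hXm
  have hmem : MemLp (Y 0) 2 P := by
    have h : MemLp X 2 (P.map fun ω => ω 0) := by
      rw [hmap]
      exact MemLp.of_discrete
    exact h.comp_of_map (measurable_pi_apply 0).aemeasurable
  have hmean : P[Y 0] = ∑ i, p i * X i := by
    have h : ∫ ω, X (ω 0) ∂P = ∫ i, X i ∂(P.map fun ω => ω 0) :=
      (integral_map (measurable_pi_apply 0).aemeasurable hXm.aestronglyMeasurable).symm
    change ∫ ω, X (ω 0) ∂P = _
    rw [h, hmap, integral_fintype (Integrable.of_finite)]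
    refine Finset.sum_congr rfl fun i _ => ?_
    rw [Measure.real, hν, ENNReal.toReal_ofReal (hpos i).le, smul_eq_mul]
  have hvar : Var[Y 0; P] ≠ 0 := by
    intro h0
    have h1 := ae_eq_integral_of_variance_eq_zero hmem h0
    have h2 : ∀ᵐ i ∂(P.map fun ω => ω 0), X i = P[Y 0] :=
      (ae_map_iff (measurable_pi_apply 0).aemeasurable (Set.toFinite _).measurableSet).2 h1
    rw [hmap] at h2
    have h3 (i : ι) : X i = P[Y 0] := by
      by_contra hi
      have h4 : ν {i} ≤ 0 := (measure_mono (by simpa using hi)).trans (ae_iff.1 h2).le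
      rw [hν, nonpos_iff_eq_zero, ENNReal.ofReal_eq_zero] at h4
      exact absurd (hpos i) (not_lt.2 h4)
    obtain ⟨i, j, hij⟩ := hX
    exact hij ((h3 i).trans (h3 j).symm)
  have hv : Var[Y 0; P].toNNReal ≠ 0 :=
    (Real.toNNReal_pos.2 (lt_of_le_of_ne (variance_nonneg _ _) hvar.symm)).ne'
  have hclt := (tendstoInDistribution_inv_sqrt_mul_sum_sub
    (P' := gaussianReal 0 Var[Y 0; P].toNNReal) (Y := id) HasLaw.id hmem hindep hident).tendsto
  have hlim := ProbabilityMeasure.le_liminf_measure_open_of_tendsto hclt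
    (isOpen_Ioo (a := z - 1) (b := z))
  have hgauss : 0 < gaussianReal 0 Var[Y 0; P].toNNReal (Set.Ioo (z - 1) z) := by
    refine pos_iff_ne_zero.2 fun h => ?_
    have := gaussianReal_absolutelyContinuous' 0 hv h
    simp at this
  simp only [ProbabilityMeasure.coe_mk, Measure.map_id] at hlim
  obtain ⟨δ, hδ0, hδ⟩ := exists_between (hgauss.trans_le hlim)
  refine ⟨δ.toReal, ENNReal.toReal_pos hδ0.ne' hδ.ne_top, ?_⟩
  filter_upwards [eventually_lt_of_lt_liminf hδ] with n hn
  set s : Finset (Fin n → ι) := Finset.univ.filter fun x =>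
    (√n)⁻¹ * ((∑ k, X (x k)) - n * ∑ i, p i * X i) ∈ Set.Ioo (z - 1) z with hs
  have hPn : P.map (fun ω (k : Fin n) => ω k) = Measure.pi fun _ => ν := by
    rw [← Measure.infinitePi_eq_pi]
    exact Measure.map_infinitePi_infinitePi_of_inj (P := fun _ : ℕ => ν) Fin.val_injective
  have hsm : MeasurableSet (s : Set (Fin n → ι)) := s.finite_toSet.measurableSet
  have hrm : Measurable fun (ω : ℕ → ι) (k : Fin n) => ω k :=
    measurable_pi_lambda _ fun k => measurable_pi_apply _
  have hmeas : P.map (fun ω => (√n)⁻¹ * (∑ k ∈ Finset.range n, Y k ω - n * P[Y 0]))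
      (Set.Ioo (z - 1) z) = ENNReal.ofReal (∑ x ∈ s, ∏ k, p (x k)) := by
    rw [Measure.map_apply (by fun_prop) measurableSet_Ioo]
    have hpre : (fun ω => (√n)⁻¹ * (∑ k ∈ Finset.range n, Y k ω - n * P[Y 0])) ⁻¹'
        Set.Ioo (z - 1) z = (fun (ω : ℕ → ι) (k : Fin n) => ω k) ⁻¹' (s : Set (Fin n → ι)) := by
      ext ω
      simp only [Set.mem_preimage, hs, Finset.coe_filter, Finset.mem_univ, true_and,
        Set.mem_ofPred_eq, hmean, Y, Finset.sum_range]
    rw [hpre, ← Measure.map_apply hrm hsm, hPn, ← sum_measure_singleton,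
      ENNReal.ofReal_sum_of_nonneg fun x _ => Finset.prod_nonneg fun k _ => (hpos _).le]
    refine Finset.sum_congr rfl fun x _ => ?_
    rw [Measure.pi_singleton, ENNReal.ofReal_prod_of_nonneg fun k _ => (hpos _).le]
    exact Finset.prod_congr rfl fun k _ => hν _
  rw [hmeas] at hn
  exact ENNReal.toReal_le_of_le_ofReal
    (Finset.sum_nonneg fun x _ => Finset.prod_nonneg fun k _ => (hpos _).le) hn.le

lemma sum_biUnion_le_sum_sum {ι κ : Type*} [DecidableEq ι] (s : Finset κ) (t : κ → Finset ι)
    (f : ι → ℝ) (hf : ∀ i, 0 ≤ f i) : ∑ i ∈ s.biUnion t, f i ≤ ∑ k ∈ s, ∑ i ∈ t k, f i := by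
  induction s using Finset.induction_on with
  | empty => simp
  | insert k s hk ih =>
    rw [Finset.biUnion_insert, Finset.sum_insert hk]
    have h := Finset.sum_union_inter (s₁ := t k) (s₂ := s.biUnion t) (f := f)
    have h' : 0 ≤ ∑ i ∈ t k ∩ s.biUnion t, f i := Finset.sum_nonneg fun i _ => hf i
    linarith

theorem stmt16 {d : ℕ} (p : Fin d → ℝ)
    (hpos : ∀ i, 0 < p i) (hsum : ∑ i, p i = 1)
    (hnonunif : ∃ i j, p i ≠ p j)
    (ε : ℝ) (hε : ε ∈ Set.Ioo (0 : ℝ) 1)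
    (c : ℝ) (hc : 0 < c)
    (hlat : (∀ c₀ : ℝ, ¬ IsLatticeSpan p c₀) ∨ IsLatticeSpan p c)
    (t : ℝ) (ht : 0 < t) :
    ∃ (C : ℝ) (N : ℕ), ∀ n ≥ N,
      |Real.log ((Finset.range (⌊t * (n : ℝ)⌋₊ + 1)).sup'
            (Finset.nonempty_range_iff.mpr (Nat.succ_ne_zero _))
            (fun k => ∑ x ∈ Rslab p ε c n k, prodP p x)) +
        (1 / 2) * Real.log n| ≤ C := by
  have hX : ∃ i j, -log (p i) ≠ -log (p j) := by
    obtain ⟨i, j, hij⟩ := hnonunif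
    exact ⟨i, j, fun h => hij (log_injOn_pos (hpos i) (hpos j) (neg_injective h))⟩
  have hS (n : ℕ) (x : Fin n → Fin d) : -log (prodP p x) = ∑ k, -log (p (x k)) := by
    rw [prodP, log_prod fun k _ => (hpos _).ne', Finset.sum_neg_distrib]
  have hH : ∑ i, p i * -log (p i) = shannonH p := by
    simp [shannonH]
  have hP (n : ℕ) (x : Fin n → Fin d) : 0 ≤ prodP p x :=
    Finset.prod_nonneg fun k _ => (hpos _).le
  obtain ⟨C, hC⟩ := exists_sum_prod_le_div_sqrt p (fun i => -log (p i)) hpos hsum hX hc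
  obtain ⟨δ, hδ, hev⟩ := exists_eventually_le_sum_prod p (fun i => -log (p i)) hpos hsum hX
    (√(varH p) * PhiInv ε)
  have hsqrt : Filter.Tendsto (fun n : ℕ => √(n : ℝ)) Filter.atTop Filter.atTop :=
    tendsto_sqrt_atTop.comp tendsto_natCast_atTop_atTop
  obtain ⟨N, hN⟩ := Filter.eventually_atTop.1
    (hev.and (hsqrt.eventually_ge_atTop (max 1 (1 / (c * t)))))
  set δ' := δ / (1 / c + 1) with hδ'
  have hδ'0 : 0 < δ' := by positivity
  refine ⟨max |log δ'| |log C|, N, fun n hn => ?_⟩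
  obtain ⟨hlow, hbig⟩ := hN n hn
  have hr1 : 1 ≤ √(n : ℝ) := (le_max_left _ _).trans hbig
  have hrt : 1 / (c * t) ≤ √(n : ℝ) := (le_max_right _ _).trans hbig
  have hr0 : 0 < √(n : ℝ) := by linarith
  have hn0 : 0 < n := Nat.pos_of_ne_zero fun h => by simp [h] at hr0
  have hnr : (n : ℝ) = √(n : ℝ) * √(n : ℝ) := (mul_self_sqrt n.cast_nonneg).symm
  set A : ℝ := (n : ℝ) * shannonH p + √n * √(varH p) * PhiInv ε with hA
  set M : ℝ := (Finset.range (⌊t * (n : ℝ)⌋₊ + 1)).sup'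
            (Finset.nonempty_range_iff.mpr (Nat.succ_ne_zero _))
            (fun k => ∑ x ∈ Rslab p ε c n k, prodP p x) with hM
  have hupper : M ≤ C / √n := by
    refine Finset.sup'_le _ _ fun k _ => ?_
    refine hC n hn0 (A - c * k) (Rslab p ε c n k) fun x hx => ?_
    rw [Rslab, Finset.mem_filter, ← hA, hS] at hx
    rw [abs_le]
    constructor <;> nlinarith [hx.2.1, hx.2.2]
  have hfloor : ⌊√(n : ℝ) / c⌋₊ ≤ ⌊t * (n : ℝ)⌋₊ := by
    refine Nat.floor_le_floor ?_
    rw [div_le_iff₀ (by positivity)] at hrt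
    rw [div_le_iff₀ hc]
    calc √(n : ℝ) ≤ √n * (√n * (c * t)) := le_mul_of_one_le_right hr0.le hrt
      _ = √n * √n * (t * c) := by ring
      _ = t * n * c := by rw [← hnr]; ring
  have hlower : δ ≤ (√n * (1 / c + 1)) * M := by
    have h1 : δ ≤ ∑ x ∈ (Finset.range (⌊√(n : ℝ) / c⌋₊ + 1)).biUnion (Rslab p ε c n),
        prodP p x := by
      refine hlow.trans (Finset.sum_le_sum_of_subset_of_nonneg ?_ fun x _ _ => hP n x)
      intro x hx
      rw [Finset.mem_filter, ← hS, hH, Set.mem_Ioo, inv_mul_eq_div, lt_div_iff₀ hr0,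
        div_lt_iff₀ hr0] at hx
      obtain ⟨-, hx1, hx2⟩ := hx
      set y := (A - -log (prodP p x)) / c with hy
      have hyc : y * c = A - -log (prodP p x) := div_mul_cancel₀ _ hc.ne'
      have hy0 : 0 ≤ y := div_nonneg (by linarith) hc.le
      have hy1 : y ≤ √n / c := div_le_div_of_nonneg_right (by linarith) hc.le
      have hf1 := mul_le_mul_of_nonneg_right (Nat.floor_le hy0) hc.le
      have hf2 := mul_lt_mul_of_pos_right (Nat.lt_floor_add_one y) hc
      rw [Finset.mem_biUnion]
      refine ⟨⌊y⌋₊, Finset.mem_range.2 (Nat.lt_succ_of_le (Nat.floor_le_floor hy1)), ?_⟩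
      rw [Rslab, Finset.mem_filter, ← hA]
      exact ⟨Finset.mem_univ _, by linarith, by linarith⟩
    have h2 : ∑ x ∈ (Finset.range (⌊√(n : ℝ) / c⌋₊ + 1)).biUnion (Rslab p ε c n), prodP p x
        ≤ ∑ k ∈ Finset.range (⌊√(n : ℝ) / c⌋₊ + 1), ∑ x ∈ Rslab p ε c n k, prodP p x :=
      sum_biUnion_le_sum_sum _ _ _ (hP n)
    have h3 : ∑ k ∈ Finset.range (⌊√(n : ℝ) / c⌋₊ + 1), ∑ x ∈ Rslab p ε c n k, prodP p x
        ≤ (⌊√(n : ℝ) / c⌋₊ + 1 : ℕ) * M := by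
      refine (Finset.sum_le_card_nsmul _ _ M fun k hk => ?_).trans_eq (by simp)
      refine Finset.le_sup' (fun k => ∑ x ∈ Rslab p ε c n k, prodP p x) ?_
      rw [Finset.mem_range] at hk ⊢
      omega
    have hM0 : 0 ≤ M :=
      (Finset.sum_nonneg fun x _ => hP n x).trans (Finset.le_sup'
        (fun k => ∑ x ∈ Rslab p ε c n k, prodP p x) (Finset.mem_range.2 (Nat.succ_pos _)))
    refine (h1.trans (h2.trans h3)).trans (mul_le_mul_of_nonneg_right ?_ hM0)
    push_cast
    have := Nat.floor_le (a := √(n : ℝ) / c) (by positivity)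
    have h4 : √(n : ℝ) * (1 / c + 1) = √n / c + √n := by ring
    linarith
  have hl : δ' ≤ M * √n := by
    rw [hδ', div_le_iff₀ (by positivity)]
    linarith
  have hu : M * √n ≤ C := (le_div_iff₀ hr0).1 hupper
  have hpos' : 0 < M * √n := hδ'0.trans_le hl
  have hM0 : 0 < M := pos_of_mul_pos_left hpos' hr0.le
  have hlog : log M + 1 / 2 * log n = log (M * √n) := by
    rw [log_mul hM0.ne' hr0.ne', log_sqrt n.cast_nonneg]
    ring
  rw [hlog]
  exact abs_le_max_abs_abs (log_le_log hδ'0 hl) (log_le_log hpos' hu)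
end
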